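/- Let k be an algebraically closed field of characteristic zero and let T = k_{−1}[u,v] # S_2 be the skew group ring where the generator h of S_2 acts by h·u = v, h·v = u. Then the two-sided ideals of T generated by uv and by u² − v² are prime ideals of T. -/

import Mathlib

/-- `T` together with `ι : A →+* T` and `j : G → T` is the skew group ring `A # G`
for the action of the finite group `G` on `A`. -/
structure IsSkewGroupRing (A : Type*) [Ring A] (G : Type*) [Group G] [Fintype G]
    [MulSemiringAction G A] (T : Type*) [Ring T] (ι : A →+* T) (j : G → T) : Prop where
  injective : Function.Injective ι
  j_one : j 1 = 1
  j_mul : ∀ g h : G, j g * j h = j (g * h)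
  comm : ∀ (g : G) (a : A), j g * ι a = ι (g • a) * j g
  basis : ∀ t : T, ∃! c : G → A, t = ∑ g : G, ι (c g) * j g

/-- A two-sided ideal `P` of a ring `R` is *prime* if it is proper and
`a R b ⊆ P` implies `a ∈ P` or `b ∈ P`. -/
def IsPrimeTwoSidedIdeal {R : Type*} [Ring R] (P : TwoSidedIdeal R) : Prop :=
  (P : Set R) ≠ Set.univ ∧ ∀ a b : R, (∀ x : R, a * x * b ∈ P) → a ∈ P ∨ b ∈ P

/-- The relation defining the quantum plane `K_q[u,v]`: `v u = q · u v`. -/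
inductive QuantumRel (K : Type*) [CommRing K] (q : K) :
    FreeAlgebra K (Fin 2) → FreeAlgebra K (Fin 2) → Prop
  | rel : QuantumRel K q (FreeAlgebra.ι K 1 * FreeAlgebra.ι K 0)
      (q • (FreeAlgebra.ι K 0 * FreeAlgebra.ι K 1))

/-- The quantum plane `K_q[u,v] = K⟨u,v⟩/(vu - q·uv)`. -/
abbrev QuantumPlane (K : Type*) [CommRing K] (q : K) := RingQuot (QuantumRel K q)

/-- The generator `u` of the quantum plane. -/
noncomputable def qU (K : Type*) [CommRing K] (q : K) : QuantumPlane K q :=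
  RingQuot.mkAlgHom K (QuantumRel K q) (FreeAlgebra.ι K 0)

/-- The generator `v` of the quantum plane. -/
noncomputable def qV (K : Type*) [CommRing K] (q : K) : QuantumPlane K q :=
  RingQuot.mkAlgHom K (QuantumRel K q) (FreeAlgebra.ι K 1)

namespace IsSkewGroupRing

variable {A G T R : Type*} [Ring A] [Group G] [Fintype G] [MulSemiringAction G A] [Ring T]
  [Ring R] {ι : A →+* T} {j : G → T}

/-- The additive map out of a skew group ring determined by maps on coefficients and on `G`. -/
theorem exists_addMonoidHom (hT : IsSkewGroupRing A G T ι j) (ψ : A →+* R) (ρ : G → R) :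
    ∃ φ : T →+ R, ∀ a g, φ (ι a * j g) = ψ a * ρ g := by
  classical
  choose c hc hu using hT.basis
  refine ⟨AddMonoidHom.mk' (fun t => ∑ g, ψ (c t g) * ρ g) fun s t => ?_, fun a g => ?_⟩
  · have : (fun g => c s g + c t g) = c (s + t) := by
      refine hu _ _ ?_
      simp only [map_add, add_mul, Finset.sum_add_distrib, ← hc]
    simp only [← this, map_add, add_mul, Finset.sum_add_distrib]
  · have : Pi.single g a = c (ι a * j g) := by
      refine hu _ _ ?_
      beta_reduce
      rw [Finset.sum_eq_single g] <;> simp +contextual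
    simp only [AddMonoidHom.mk'_apply, ← this]
    rw [Finset.sum_eq_single g] <;> simp +contextual

/-- The universal property of a skew group ring: covariant pairs extend to ring maps. -/
theorem exists_ringHom (hT : IsSkewGroupRing A G T ι j) (ψ : A →+* R) (ρ : G →* R)
    (hψρ : ∀ g a, ρ g * ψ a = ψ (g • a) * ρ g) :
    ∃ φ : T →+* R, (∀ a, φ (ι a) = ψ a) ∧ ∀ g, φ (j g) = ρ g := by
  obtain ⟨φ, hφ⟩ := hT.exists_addMonoidHom ψ ρ
  have hι (a : A) : φ (ι a) = ψ a := by simpa [hT.j_one] using hφ a 1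
  have hj (g : G) : φ (j g) = ρ g := by simpa using hφ 1 g
  have hmul (s t : T) : φ (s * t) = φ s * φ t := by
    obtain ⟨c, rfl, -⟩ := hT.basis s
    obtain ⟨d, rfl, -⟩ := hT.basis t
    simp only [Finset.sum_mul_sum, map_sum]
    refine Finset.sum_congr rfl fun g _ => Finset.sum_congr rfl fun g' _ => ?_
    have : ι (c g) * j g * (ι (d g') * j g') = ι (c g * g • d g') * j (g * g') := by
      rw [mul_assoc, ← mul_assoc (j g), hT.comm, map_mul, ← hT.j_mul]
      simp only [mul_assoc]
    rw [this, hφ, hφ, hφ, map_mul, map_mul, mul_assoc (ψ (c g)), ← mul_assoc (ψ (g • _)),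
      ← hψρ]
    simp only [mul_assoc]
  exact ⟨{ φ with
    map_one' := by simpa [hT.j_one] using hj 1
    map_mul' := hmul }, hι, hj⟩

/-- A skew group ring over a group of order two is `A ⊕ A h`. -/
theorem exists_eq_add (hT : IsSkewGroupRing A G T ι j) {h : G} (h1 : h ≠ 1)
    (hG : ∀ x : G, x = 1 ∨ x = h) (t : T) : ∃ a b : A, t = ι a + ι b * j h := by
  classical
  obtain ⟨c, hc, -⟩ := hT.basis t
  have : (Finset.univ : Finset G) = {1, h} := by
    ext x
    simpa using hG x
  refine ⟨c 1, c h, ?_⟩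
  rw [hc, this, Finset.sum_pair h1.symm, hT.j_one, mul_one]

end IsSkewGroupRing

open Polynomial

theorem RingHom.map_eq_zero_of_mem_span_singleton {R S : Type*} [Ring R] [Ring S] (φ : R →+* S)
    {x t : R} (hx : φ x = 0) (ht : t ∈ TwoSidedIdeal.span {x}) : φ t = 0 := by
  have : TwoSidedIdeal.span {x} ≤ TwoSidedIdeal.ker φ := by
    rw [TwoSidedIdeal.span_le]
    simpa [TwoSidedIdeal.mem_ker] using hx
  exact (TwoSidedIdeal.mem_ker φ).1 (this ht)

/-- If `φ : T → M₂(k[X])` has kernel generated by `x` and its image contains all `X E_{ij}`,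
then the ideal generated by `x` is prime. -/
theorem isPrimeTwoSidedIdeal_span_of_matrix {k T : Type*} [Field k] [Ring T]
    (φ : T →+* Matrix (Fin 2) (Fin 2) k[X]) {x : T} (hx : φ x = 0)
    (hker : ∀ t, φ t = 0 → t ∈ TwoSidedIdeal.span {x})
    (him : ∀ p q, ∃ t, φ t = Matrix.single p q X) :
    IsPrimeTwoSidedIdeal (TwoSidedIdeal.span {x}) := by
  have hle := fun t => φ.map_eq_zero_of_mem_span_singleton hx (t := t)
  refine ⟨fun h => ?_, fun a b hab => ?_⟩
  · have := hle 1 (show (1 : T) ∈ (TwoSidedIdeal.span {x} : Set T) from h ▸ Set.mem_univ _)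
    simp at this
  · by_contra! hcon
    have ha : φ a ≠ 0 := fun h => hcon.1 (hker _ h)
    have hb : φ b ≠ 0 := fun h => hcon.2 (hker _ h)
    obtain ⟨p, q, hpq⟩ : ∃ p q, φ a p q ≠ 0 := by
      by_contra! h
      exact ha (Matrix.ext h)
    obtain ⟨r, s, hrs⟩ : ∃ r s, φ b r s ≠ 0 := by
      by_contra! h
      exact hb (Matrix.ext h)
    obtain ⟨t, ht⟩ := him q r
    have := congrFun (congrFun (hle _ (hab t)) p) s
    rw [map_mul, map_mul, ht, Matrix.mul_apply, Finset.sum_eq_single r] at this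
    · simp [hpq, hrs] at this
    · intro i _ hi
      simp [Matrix.mul_single_apply_of_ne _ _ _ _ _ hi]
    · simp

section Generators

variable {k A : Type*} [Field k] [Ring A] [Algebra k A] {u v : A}

/-- A subspace containing `1` and stable under left multiplication by the generators `u`, `v` of
an algebra is everything. -/
theorem Submodule.mem_of_adjoin_pair_eq_top (htop : Algebra.adjoin k {u, v} = ⊤)
    (S : Submodule k A) (h1 : 1 ∈ S) (hu : ∀ s ∈ S, u * s ∈ S) (hv : ∀ s ∈ S, v * s ∈ S) (a : A) :
    a ∈ S := by
  have key : ∀ b ∈ Algebra.adjoin k {u, v}, ∀ s ∈ S, b * s ∈ S := by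
    intro b hb
    induction hb using Algebra.adjoin_induction with
    | mem x hx => rcases hx with rfl | rfl <;> assumption
    | algebraMap r => exact fun s hs => by simpa [← Algebra.smul_def] using S.smul_mem r hs
    | add x y _ _ hx hy =>
        intro s hs
        rw [add_mul]
        exact S.add_mem (hx s hs) (hy s hs)
    | mul x y _ _ hx hy =>
        intro s hs
        rw [mul_assoc]
        exact hx _ (hy _ hs)
  simpa using key a (by simp [htop]) 1 h1

/-- The subspace of elements of the form `f(u) + v g(w)` modulo `I`. -/
def normalFormSubmodule (k : Type*) {A : Type*} [Field k] [Ring A] [Algebra k A] (u v w : A)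
    (I : TwoSidedIdeal A) : Submodule k A where
  carrier := {a | ∃ f g : k[X], a - (aeval u f + v * aeval w g) ∈ I}
  zero_mem' := ⟨0, 0, by simp [I.zero_mem]⟩
  add_mem' := by
    rintro a b ⟨f, g, ha⟩ ⟨f', g', hb⟩
    refine ⟨f + f', g + g', ?_⟩
    convert I.add_mem ha hb using 1
    simp only [map_add, mul_add]
    abel
  smul_mem' := by
    rintro c a ⟨f, g, ha⟩
    refine ⟨C c * f, C c * g, ?_⟩
    convert I.mul_mem_left (algebraMap k _ c) _ ha using 1
    simp only [map_mul, aeval_C, mul_sub, mul_add, Algebra.smul_def]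
    rw [← mul_assoc v, ← Algebra.commutes, mul_assoc]

/-- Modulo `uv`, every element of the algebra is of the form `f(u) + v g(v)`. -/
theorem exists_normalForm_uv (htop : Algebra.adjoin k {u, v} = ⊤)
    (hvu : v * u = -(u * v)) (I : TwoSidedIdeal A)
    (hI : u * v ∈ I) (a : A) :
    ∃ f g : k[X], a - (aeval u f + v * aeval v g) ∈ I := by
  refine Submodule.mem_of_adjoin_pair_eq_top htop (normalFormSubmodule k u v v I)
    ⟨1, 0, by simp [I.zero_mem]⟩ ?_ ?_ a
  · rintro a ⟨f, g, ha⟩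
    refine ⟨X * f, 0, ?_⟩
    convert I.add_mem (I.mul_mem_left u _ ha)
      (I.mul_mem_right _ (aeval v g) hI) using 1
    simp only [map_mul, aeval_X, map_zero, mul_zero]
    noncomm_ring
  · rintro a ⟨f, g, ha⟩
    refine ⟨0, C (f.coeff 0) + X * g, ?_⟩
    have hf : f = X * f.divX + C (f.coeff 0) := by rw [mul_comm, divX_mul_X_add]
    convert I.add_mem (I.mul_mem_left v _ ha)
      (I.mul_mem_right _ (-aeval u f.divX) hI) using 1
    nth_rw 2 [hf]
    simp only [map_mul, aeval_X, map_zero, map_add, aeval_C, mul_sub, mul_add, ← mul_assoc, hvu]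
    noncomm_ring

/-- Modulo `u² - v²`, every element of the algebra is of the form `f(u) + v g(u)`. -/
theorem exists_normalForm_sq (htop : Algebra.adjoin k {u, v} = ⊤)
    (hvu : v * u = -(u * v)) (I : TwoSidedIdeal A)
    (hI : u ^ 2 - v ^ 2 ∈ I) (a : A) :
    ∃ f g : k[X], a - (aeval u f + v * aeval u g) ∈ I := by
  refine Submodule.mem_of_adjoin_pair_eq_top htop (normalFormSubmodule k u v u I)
    ⟨1, 0, by simp [I.zero_mem]⟩ ?_ ?_ a
  · rintro a ⟨f, g, ha⟩
    refine ⟨X * f, -(X * g), ?_⟩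
    convert I.mul_mem_left u _ ha using 1
    simp only [map_mul, aeval_X, map_neg, mul_neg, mul_sub, mul_add, ← mul_assoc, hvu]
    noncomm_ring
  · rintro a ⟨f, g, ha⟩
    refine ⟨X ^ 2 * g, f, ?_⟩
    convert I.sub_mem (I.mul_mem_left v _ ha)
      (I.mul_mem_right _ (aeval u g) hI) using 1
    simp only [map_mul, map_pow, aeval_X]
    noncomm_ring

end Generators

section QuantumPlane

variable {k : Type*} [Field k]

theorem qV_mul_qU (q : k) : qV k q * qU k q = q • (qU k q * qV k q) := by
  have := RingQuot.mkAlgHom_rel k (QuantumRel.rel (K := k) (q := q))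
  simpa [qU, qV] using this

theorem qV_mul_qU_neg_one : qV k (-1) * qU k (-1) = -(qU k (-1) * qV k (-1)) :=
  (qV_mul_qU _).trans (neg_one_smul k (qU k (-1) * qV k (-1)))

theorem QuantumPlane.adjoin_eq_top (q : k) : Algebra.adjoin k {qU k q, qV k q} = ⊤ := by
  have h := congrArg (Subalgebra.map (RingQuot.mkAlgHom k (QuantumRel k q)))
    (FreeAlgebra.adjoin_range_ι k (Fin 2))
  rw [AlgHom.map_adjoin, Algebra.map_top,
    (AlgHom.range_eq_top _).2 (RingQuot.mkAlgHom_surjective k _)] at h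
  rw [← h, ← Set.range_comp]
  congr 1
  ext x
  simp [qU, qV, eq_comm]

theorem QuantumPlane.exists_lift {R : Type*} [Ring R] [Algebra k R] {q : k} {U V : R}
    (hUV : V * U = q • (U * V)) :
    ∃ ψ : QuantumPlane k q →ₐ[k] R, ψ (qU k q) = U ∧ ψ (qV k q) = V := by
  refine ⟨RingQuot.liftAlgHom k ⟨FreeAlgebra.lift k ![U, V], ?_⟩, ?_, ?_⟩
  · rintro _ _ ⟨⟩
    simpa using hUV
  · simp [qU]
  · simp [qV]

/-- Representations of `k_{-1}[u,v] # S₂` are given by anticommuting `U`, `V` that are swapped by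
an involution `H`. -/
theorem IsSkewGroupRing.exists_representation {G T R : Type*} [Group G] [Fintype G] {h : G}
    (h1 : h ≠ 1) (hh : h * h = 1) (hG : ∀ x : G, x = 1 ∨ x = h)
    [MulSemiringAction G (QuantumPlane k (-1 : k))]
    [SMulCommClass G k (QuantumPlane k (-1 : k))]
    (hu : h • qU k (-1 : k) = qV k (-1 : k)) (hv : h • qV k (-1 : k) = qU k (-1 : k))
    [Ring T] {ι : QuantumPlane k (-1 : k) →+* T} {j : G → T}
    (hT : IsSkewGroupRing (QuantumPlane k (-1 : k)) G T ι j) [Ring R] [Algebra k R]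
    {U V H : R} (hVU : V * U = -(U * V)) (hHH : H * H = 1) (hHU : H * U = V * H)
    (hHV : H * V = U * H) :
    ∃ (ψ : QuantumPlane k (-1 : k) →ₐ[k] R) (φ : T →+* R), ψ (qU k (-1)) = U ∧
      ψ (qV k (-1)) = V ∧ (∀ a, φ (ι a) = ψ a) ∧ φ (j h) = H := by
  classical
  obtain ⟨ψ, hψU, hψV⟩ := QuantumPlane.exists_lift (k := k) (q := -1) (U := U) (V := V)
    (by rw [hVU, neg_one_smul])
  let ρ : G →* R :=
    { toFun := fun g => if g = 1 then 1 else H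
      map_one' := by simp
      map_mul' := fun x y => by
        rcases hG x with rfl | rfl <;> rcases hG y with rfl | rfl <;> simp [h1, hh, hHH] }
  have hρ : ρ h = H := if_neg h1
  have hcov (a : QuantumPlane k (-1 : k)) : H * ψ a = ψ (h • a) * H := by
    let S : Submodule k (QuantumPlane k (-1)) :=
      { carrier := {a | H * ψ a = ψ (h • a) * H}
        zero_mem' := by simp
        add_mem' := fun {a b} (ha : _ = _) (hb : _ = _) => by
          simp [mul_add, add_mul, ha, hb]
        smul_mem' := fun c a (ha : _ = _) => by
          simp [smul_comm h c a, ha] }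
    refine Submodule.mem_of_adjoin_pair_eq_top (QuantumPlane.adjoin_eq_top _) S
      (by simp [S]) ?_ ?_ a
    · intro s (hs : _ = _)
      change _ = _
      rw [smul_mul', hu, map_mul, map_mul, hψU, hψV, ← mul_assoc, hHU, mul_assoc, hs, mul_assoc]
    · intro s (hs : _ = _)
      change _ = _
      rw [smul_mul', hv, map_mul, map_mul, hψU, hψV, ← mul_assoc, hHV, mul_assoc, hs, mul_assoc]
  obtain ⟨φ, hφ, hφj⟩ := hT.exists_ringHom (ψ : QuantumPlane k (-1 : k) →+* R) ρ (by
    intro g a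
    rcases hG g with rfl | rfl
    · simp
    · rw [hρ]
      exact hcov a)
  exact ⟨ψ, φ, hψU, hψV, hφ, (hφj h).trans hρ⟩

end QuantumPlane

theorem aeval_matrix_diagonal {k R n : Type*} [CommRing k] [CommRing R] [Algebra k R]
    [Fintype n] [DecidableEq n] (d : n → R) (f : k[X]) :
    aeval (Matrix.diagonal d) f = Matrix.diagonal fun i => aeval (d i) f := by
  have := aeval_algHom_apply (Matrix.diagonalAlgHom (n := n) (α := R) k) d f
  simpa [aeval_pi_apply] using this

/-- In `T = k_{-1}[u,v] # S₂`, the two-sided ideals generated by `uv` and by `u² - v²`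
are prime. -/
theorem uv_and_u2v2_prime_in_skewGroupRing
    (k : Type) [Field k] [IsAlgClosed k] [CharZero k]
    (G : Type) [Group G] [Fintype G] (h : G)
    (hord : orderOf h = 2) (hG : ∀ x : G, x = 1 ∨ x = h)
    [MulSemiringAction G (QuantumPlane k (-1 : k))]
    [SMulCommClass G k (QuantumPlane k (-1 : k))]
    (hu : h • qU k (-1 : k) = qV k (-1 : k)) (hv : h • qV k (-1 : k) = qU k (-1 : k))
    (T : Type) [Ring T] (iota : QuantumPlane k (-1 : k) →+* T) (j : G → T)
    (hT : IsSkewGroupRing (QuantumPlane k (-1 : k)) G T iota j) :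
    IsPrimeTwoSidedIdeal (TwoSidedIdeal.span {iota (qU k (-1 : k) * qV k (-1 : k))}) ∧
    IsPrimeTwoSidedIdeal
      (TwoSidedIdeal.span {iota (qU k (-1 : k) ^ 2 - qV k (-1 : k) ^ 2)}) := by
  have h1 : h ≠ 1 := by
    rintro rfl
    simp at hord
  have hh : h * h = 1 := by rw [← sq, ← hord, pow_orderOf_eq_one]
  constructor
  · obtain ⟨ψ, φ, hψU, hψV, hφ, hφj⟩ := hT.exists_representation h1 hh hG hu hv
      (U := Matrix.diagonal ![X, 0]) (V := Matrix.diagonal ![0, X])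
      (H := (!![0, 1; 1, 0] : Matrix (Fin 2) (Fin 2) k[X]))
      (by ext i l; fin_cases i <;> fin_cases l <;> simp)
      (by ext i l; fin_cases i <;> fin_cases l <;> simp)
      (by ext i l; fin_cases i <;> fin_cases l <;> simp)
      (by ext i l; fin_cases i <;> fin_cases l <;> simp)
    have hx : φ (iota (qU k (-1) * qV k (-1))) = 0 := by
      rw [hφ, map_mul, hψU, hψV]
      ext i l; fin_cases i <;> fin_cases l <;> simp
    set P := TwoSidedIdeal.span {iota (qU k (-1 : k) * qV k (-1 : k))}
    have hnf (a : QuantumPlane k (-1 : k)) : ∃ f g : k[X],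
        ψ a = !![f, 0; 0, C (f.coeff 0) + X * g] ∧ (f = 0 → g = 0 → iota a ∈ P) := by
      obtain ⟨f, g, hfg⟩ := exists_normalForm_uv (QuantumPlane.adjoin_eq_top _)
        qV_mul_qU_neg_one (P.comap iota) ((TwoSidedIdeal.mem_comap _).2
          (TwoSidedIdeal.subset_span rfl)) a
      rw [TwoSidedIdeal.mem_comap] at hfg
      refine ⟨f, g, ?_, ?_⟩
      · have h0 := φ.map_eq_zero_of_mem_span_singleton hx hfg
        rw [hφ, map_sub, sub_eq_zero] at h0
        rw [h0, map_add, map_mul, ← aeval_algHom_apply, ← aeval_algHom_apply, hψU, hψV,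
          aeval_matrix_diagonal, aeval_matrix_diagonal]
        have haev : aeval (0 : k[X]) f = C (f.coeff 0) := (coeff_zero_eq_aeval_zero' f).symm
        ext1 i l
        fin_cases i <;> fin_cases l <;> simp [haev]
      · rintro rfl rfl
        simpa using hfg
    refine isPrimeTwoSidedIdeal_span_of_matrix φ hx (fun t ht => ?_) fun p q => ?_
    · obtain ⟨a, b, rfl⟩ := hT.exists_eq_add h1 hG t
      obtain ⟨f, g, ha, haP⟩ := hnf a
      obtain ⟨f', g', hb, hbP⟩ := hnf b
      rw [map_add, map_mul, hφ, hφ, hφj, ha, hb] at ht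
      have e00 : f = 0 := by simpa using congrFun (congrFun ht 0) 0
      have e01 : f' = 0 := by simpa using congrFun (congrFun ht 0) 1
      have e10 : g' = 0 := by simpa [e01] using congrFun (congrFun ht 1) 0
      have e11 : g = 0 := by simpa [e00] using congrFun (congrFun ht 1) 1
      exact P.add_mem (haP e00 e11) (P.mul_mem_right _ _ (hbP e01 e10))
    · refine ⟨iota (!![qU k (-1), qU k (-1); qV k (-1), qV k (-1)] p q) *
        !![1, j h; j h, 1] p q, ?_⟩
      fin_cases p <;> fin_cases q <;> ext1 i l <;> fin_cases i <;> fin_cases l <;>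
        simp [hφ, hφj, hψU, hψV]
  · obtain ⟨d, hd⟩ : ∃ d : k, 2 * (d * d) = 1 := by
      obtain ⟨d, hd⟩ := IsAlgClosed.exists_eq_mul_self (2⁻¹ : k)
      exact ⟨d, by rw [← hd, mul_inv_cancel₀ two_ne_zero]⟩
    have hdC : 2 * (C d * C d) = (1 : k[X]) := by
      rw [← C_mul, ← C_ofNat, ← C_mul, hd, C_1]
    obtain ⟨ψ, φ, hψU, hψV, hφ, hφj⟩ := hT.exists_representation h1 hh hG hu hv
      (U := Matrix.diagonal ![X, -X]) (V := !![0, X; X, 0])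
      (H := (!![C d, C d; C d, -C d] : Matrix (Fin 2) (Fin 2) k[X]))
      (by ext1 i l; fin_cases i <;> fin_cases l <;> simp)
      (by ext1 i l; fin_cases i <;> fin_cases l <;> simp <;> linear_combination hdC)
      (by ext1 i l; fin_cases i <;> fin_cases l <;> simp)
      (by ext1 i l; fin_cases i <;> fin_cases l <;> simp)
    have hx : φ (iota (qU k (-1) ^ 2 - qV k (-1) ^ 2)) = 0 := by
      rw [hφ, map_sub, map_pow, map_pow, hψU, hψV]
      ext1 i l; fin_cases i <;> fin_cases l <;> simp [sq]
    set P := TwoSidedIdeal.span {iota (qU k (-1 : k) ^ 2 - qV k (-1 : k) ^ 2)}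
    let σ : k[X] →ₐ[k] k[X] := aeval (-X)
    have hσX : σ X = -X := aeval_X _
    have hσC (c : k) : σ (C c) = C c := aeval_C _ _
    have hσσ (f : k[X]) : σ (σ f) = f := by
      have : σ.comp σ = AlgHom.id k _ := by
        ext
        simp [hσX]
      exact DFunLike.congr_fun this f
    have hnf (a : QuantumPlane k (-1 : k)) : ∃ f g : k[X],
        ψ a = !![f, X * σ g; X * g, σ f] ∧ (f = 0 → g = 0 → iota a ∈ P) := by
      obtain ⟨f, g, hfg⟩ := exists_normalForm_sq (QuantumPlane.adjoin_eq_top _)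
        qV_mul_qU_neg_one (P.comap iota) ((TwoSidedIdeal.mem_comap _).2
          (TwoSidedIdeal.subset_span rfl)) a
      rw [TwoSidedIdeal.mem_comap] at hfg
      refine ⟨f, g, ?_, ?_⟩
      · have h0 := φ.map_eq_zero_of_mem_span_singleton hx hfg
        rw [hφ, map_sub, sub_eq_zero] at h0
        rw [h0, map_add, map_mul, ← aeval_algHom_apply, ← aeval_algHom_apply, hψU, hψV,
          aeval_matrix_diagonal, aeval_matrix_diagonal]
        ext1 i l
        rw [Matrix.add_apply, Matrix.mul_diagonal]
        fin_cases i <;> fin_cases l <;> simp [σ]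
      · rintro rfl rfl
        simpa using hfg
    refine isPrimeTwoSidedIdeal_span_of_matrix φ hx (fun t ht => ?_) fun p q => ?_
    · obtain ⟨a, b, rfl⟩ := hT.exists_eq_add h1 hG t
      obtain ⟨f, g, ha, haP⟩ := hnf a
      obtain ⟨f', g', hb, hbP⟩ := hnf b
      rw [map_add, map_mul, hφ, hφ, hφj, ha, hb] at ht
      have e00 : f + (f' * C d + X * σ g' * C d) = 0 := by simpa using congrFun (congrFun ht 0) 0
      have e01 : X * σ g + (f' * C d - X * σ g' * C d) = 0 := by
        simpa [sub_eq_add_neg] using congrFun (congrFun ht 0) 1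
      have e10 : X * g + (X * g' * C d + σ f' * C d) = 0 := by
        simpa using congrFun (congrFun ht 1) 0
      have e11 : σ f + (X * g' * C d - σ f' * C d) = 0 := by
        simpa [sub_eq_add_neg] using congrFun (congrFun ht 1) 1
      have e10' := congrArg σ e10
      have e11' := congrArg σ e11
      simp only [map_add, map_sub, map_mul, map_zero, hσX, hσC, hσσ] at e10' e11'
      have hf' : 2 * f' = 0 := by
        linear_combination C d * (e00 - e11' + e01 + e10') - 2 * f' * hdC
      have hg' : 2 * (X * σ g') = 0 := by
        linear_combination C d * (e00 - e11' - e01 - e10') - 2 * (X * σ g') * hdC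
      obtain rfl : f' = 0 := by simpa using hf'
      obtain rfl : g' = 0 := by
        rw [← hσσ g', show σ g' = 0 by simpa using hg', map_zero]
      obtain rfl : f = 0 := by simpa using e00
      obtain rfl : g = 0 := by simpa using e10
      exact P.add_mem (haP rfl rfl) (P.mul_mem_right _ _ (hbP rfl rfl))
    · have hlin (α β : k) : ψ (algebraMap k _ α * qU k (-1) + algebraMap k _ β * qV k (-1)) =
          !![C α * X, C β * X; C β * X, -(C α * X)] := by
        rw [map_add, map_mul, map_mul, hψU, hψV, AlgHom.commutes, AlgHom.commutes,
          Matrix.algebraMap_eq_diagonal, Matrix.algebraMap_eq_diagonal]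
        ext1 i l
        rw [Matrix.add_apply, Matrix.diagonal_mul, Matrix.diagonal_mul]
        fin_cases i <;> fin_cases l <;> simp
      have hsingle {α β γ δ : k} (hm : !![α + d * (γ + δ), β + d * (γ - δ);
          β + d * (δ - γ), -α + d * (γ + δ)] = Matrix.single p q 1) :
          ∃ t, φ t = Matrix.single p q X := by
        refine ⟨iota (algebraMap k _ α * qU k (-1) + algebraMap k _ β * qV k (-1)) +
          iota (algebraMap k _ γ * qU k (-1) + algebraMap k _ δ * qV k (-1)) * j h, ?_⟩
        have hmap : (Matrix.single p q (1 : k)).map (fun c => X * C c) = Matrix.single p q X := by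
          ext1 i l
          simp only [Matrix.map_apply, Matrix.single_apply]
          split_ifs <;> simp
        rw [map_add φ, map_mul φ, hφ, hφ, hφj, hlin, hlin, ← hmap, ← hm]
        ext1 i l
        fin_cases i <;> fin_cases l <;> simp <;> ring
      fin_cases p <;> fin_cases q
      · refine hsingle (α := d ^ 2) (β := 0) (γ := d ^ 3) (δ := d ^ 3) ?_
        ext i l
        fin_cases i <;> fin_cases l <;> simp <;> grind
      · refine hsingle (α := 0) (β := d ^ 2) (γ := d ^ 3) (δ := -d ^ 3) ?_
        ext i l
        fin_cases i <;> fin_cases l <;> simp <;> grind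
      · refine hsingle (α := 0) (β := d ^ 2) (γ := -d ^ 3) (δ := d ^ 3) ?_
        ext i l
        fin_cases i <;> fin_cases l <;> simp <;> grind
      · refine hsingle (α := -d ^ 2) (β := 0) (γ := d ^ 3) (δ := d ^ 3) ?_
        ext i l
        fin_cases i <;> fin_cases l <;> simp <;> grind
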